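/- arXiv:2204.07116 — 5 statements merged into one kernel-verified Lean document; each statement's English description precedes it below -/
import Mathlib

section
/- Let E be a finite extension of Q_p. For each m ≥ 0, LA_m(Z_p^d, E) equipped with the norm ‖f‖ = sup_{a,k} |c_{a,k}| (where a ranges over {0,...,p^m−1}^d, f_a = Σ_k c_{a,k} T^k is the power series with f(a + p^m x) = f_a(x), and k ranges over multi-indices) is an E-Banach space, and the natural inclusion LA_m(Z_p^d, E) → LA_{m+1}(Z_p^d, E) is a compact operator of E-Banach spaces. -/
/-!
Locally analytic and locally Iwasawa functions on `ℤ_p^d` with values in a complete,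
separated commutative topological ring `B` in which `p` is topologically nilpotent.
-/

open Filter

/-- `PSEval p c x y` says that the power series with coefficient family `c` (indexed by
multi-indices `k : Fin d →₀ ℕ`), evaluated at the point `x ∈ ℤ_p^d`, converges in `B`
with sum `y`. -/
def PSEval (p : ℕ) [Fact p.Prime] {d : ℕ} {B : Type*} [CommRing B] [TopologicalSpace B]
    [Algebra ℤ_[p] B] (c : (Fin d →₀ ℕ) → B) (x : Fin d → ℤ_[p]) (y : B) : Prop :=
  HasSum (fun k : Fin d →₀ ℕ => c k * algebraMap ℤ_[p] B (∏ i, x i ^ k i)) y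

/-- `f ∈ LA_m(ℤ_p^d, B)`: around every point `a`, `f(a + p^m x)` is given by a power series
in `x` with coefficients tending to `0` in `B`. -/
def IsLA (p : ℕ) [Fact p.Prime] (m d : ℕ) {B : Type*} [CommRing B] [TopologicalSpace B]
    [Algebra ℤ_[p] B] (f : (Fin d → ℤ_[p]) → B) : Prop :=
  ∀ a : Fin d → ℤ_[p], ∃ c : (Fin d →₀ ℕ) → B,
    Tendsto c cofinite (nhds 0) ∧
    ∀ x : Fin d → ℤ_[p], PSEval p c x (f fun i => a i + (p : ℤ_[p]) ^ m * x i)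

/-- `f ∈ LI_m(ℤ_p^d, B)` (locally Iwasawa functions): around every point `a`,
`f(a + p^m x)` is given by a power series evaluated at `p ⬝ x`. -/
def IsLI (p : ℕ) [Fact p.Prime] (m d : ℕ) {B : Type*} [CommRing B] [TopologicalSpace B]
    [Algebra ℤ_[p] B] (f : (Fin d → ℤ_[p]) → B) : Prop :=
  ∀ a : Fin d → ℤ_[p], ∃ c : (Fin d →₀ ℕ) → B,
    ∀ x : Fin d → ℤ_[p], PSEval p c (fun i => (p : ℤ_[p]) * x i)
      (f fun i => a i + (p : ℤ_[p]) ^ m * x i)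

variable (p : ℕ) [Fact p.Prime]

open Classical in
/-- The coefficient sup-norm `‖f‖ = sup_{a, k} |c_{a,k}|` on `LA_m(ℤ_p^d, E)`, where `a`
ranges over the coset representatives `{0, ..., p^m - 1}^d` and `c_{a,k}` are the
coefficients of the power series of `f` around `a` (which are uniquely determined by `f`). -/
noncomputable def laNorm (p : ℕ) [Fact p.Prime] (m d : ℕ) {E : Type*} [NormedField E]
    [Algebra ℤ_[p] E] (f : (Fin d → ℤ_[p]) → E) : ℝ :=
  if h : IsLA p m d f then
    ⨆ (a : Fin d → Fin (p ^ m)) (k : Fin d →₀ ℕ),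
      ‖(Classical.choose (h fun i => ((a i : ℕ) : ℤ_[p]))) k‖
  else 0

open IsUltrametricDist

section

variable {p} {d : ℕ} {E : Type*} [NormedField E] [Algebra ℤ_[p] E]

/-- `c` is the coefficient family of a convergent power series expansion of `f` on `a + p^m ℤ_p^d`. -/
def IsExpansion (m : ℕ) (f : (Fin d → ℤ_[p]) → E) (a : Fin d → ℤ_[p])
    (c : (Fin d →₀ ℕ) → E) : Prop :=
  Tendsto c cofinite (nhds 0) ∧
    ∀ x : Fin d → ℤ_[p], PSEval p c x (f fun i => a i + (p : ℤ_[p]) ^ m * x i)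

theorem IsLA.exists_isExpansion {m : ℕ} {f : (Fin d → ℤ_[p]) → E} (hf : IsLA p m d f)
    (a : Fin d → ℤ_[p]) : ∃ c, IsExpansion m f a c :=
  hf a

theorem isLA_of_isExpansion {m : ℕ} {f : (Fin d → ℤ_[p]) → E}
    {c : (Fin d → ℤ_[p]) → (Fin d →₀ ℕ) → E} (h : ∀ a, IsExpansion m f a (c a)) :
    IsLA p m d f :=
  fun a => ⟨c a, h a⟩

namespace IsExpansion

variable {m : ℕ} {f g : (Fin d → ℤ_[p]) → E} {a : Fin d → ℤ_[p]} {c c' : (Fin d →₀ ℕ) → E}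

theorem add (h : IsExpansion m f a c) (h' : IsExpansion m g a c') :
    IsExpansion m (f + g) a (c + c') := by
  refine ⟨by simpa [Pi.add_def] using h.1.add h'.1, fun x => ?_⟩
  have := (h.2 x).add (h'.2 x)
  simpa [PSEval, add_mul] using this

theorem smul (h : IsExpansion m f a c) (r : E) : IsExpansion m (r • f) a (r • c) := by
  refine ⟨by simpa [Pi.smul_def] using h.1.const_smul r, fun x => ?_⟩
  have := (h.2 x).const_smul r
  simpa [PSEval, mul_assoc] using this

theorem sub (h : IsExpansion m f a c) (h' : IsExpansion m g a c') :
    IsExpansion m (f - g) a (c - c') := by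
  refine ⟨by simpa [Pi.sub_def] using h.1.sub h'.1, fun x => ?_⟩
  have := (h.2 x).sub (h'.2 x)
  simpa [PSEval, sub_mul] using this

theorem apply_center (h : IsExpansion m f a c) : f a = c 0 := by
  have h0 := h.2 0
  have h1 : HasSum (fun k : Fin d →₀ ℕ => c k * algebraMap ℤ_[p] E (∏ i, (0 : ℤ_[p]) ^ k i))
      (c 0) := by
    have := hasSum_single
      (f := fun k : Fin d →₀ ℕ => c k * algebraMap ℤ_[p] E (∏ i, (0 : ℤ_[p]) ^ k i)) 0
      (fun k hk => by
        obtain ⟨i, hi⟩ : ∃ i, k i ≠ 0 := by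
          by_contra! hcon
          exact hk (Finsupp.ext hcon)
        rw [Finset.prod_eq_zero (Finset.mem_univ i) (zero_pow (M₀ := ℤ_[p]) hi), map_zero,
          mul_zero])
    simpa using this
  have h2 := h0.unique h1
  simpa using h2

theorem bddAbove (h : IsExpansion m f a c) : BddAbove (Set.range fun k => ‖c k‖) :=
  h.1.norm.bddAbove_range_of_cofinite

end IsExpansion

theorem prod_mul_pow_eq (k : Fin d →₀ ℕ) (x : Fin d → ℤ_[p]) (t : ℤ_[p]) :
    ∏ i, (t * x i) ^ k i = t ^ k.degree * ∏ i, x i ^ k i := by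
  rw [Finsupp.degree_eq_sum]
  simp [mul_pow, Finset.prod_mul_distrib, Finset.prod_pow_eq_pow_sum]

theorem norm_mul_algebraMap_le (hA : ∀ z : ℤ_[p], ‖algebraMap ℤ_[p] E z‖ = ‖z‖) (y : E)
    (z : ℤ_[p]) : ‖y * algebraMap ℤ_[p] E z‖ ≤ ‖y‖ := by
  rw [norm_mul, hA]
  exact mul_le_of_le_one_right (norm_nonneg _) (PadicInt.norm_le_one z)

theorem norm_algebraMap_p_pow (hA : ∀ z : ℤ_[p], ‖algebraMap ℤ_[p] E z‖ = ‖z‖) (n : ℕ) :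
    ‖algebraMap ℤ_[p] E ((p : ℤ_[p]) ^ n)‖ = ((p : ℝ)⁻¹) ^ n := by
  rw [hA, norm_pow, PadicInt.norm_p]

/-- An expansion on `a + p^m ℤ_p^d` restricts to `a + p^(m+1) ℤ_p^d`. -/
theorem IsExpansion.succ (hA : ∀ z : ℤ_[p], ‖algebraMap ℤ_[p] E z‖ = ‖z‖) {m : ℕ}
    {f : (Fin d → ℤ_[p]) → E} {a : Fin d → ℤ_[p]} {c : (Fin d →₀ ℕ) → E}
    (h : IsExpansion m f a c) :
    IsExpansion (m + 1) f a (fun k => c k * algebraMap ℤ_[p] E ((p : ℤ_[p]) ^ k.degree)) := by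
  refine ⟨squeeze_zero_norm (fun k => norm_mul_algebraMap_le hA _ _) (by simpa using h.1.norm),
    fun x => ?_⟩
  have := h.2 (fun i => (p : ℤ_[p]) * x i)
  unfold PSEval at this ⊢
  simp only [prod_mul_pow_eq, map_mul, ← mul_assoc] at this ⊢
  simpa only [pow_succ] using this

theorem exists_eq_natCast_add (m : ℕ) (a : Fin d → ℤ_[p]) :
    ∃ (r : Fin d → Fin (p ^ m)) (b : Fin d → ℤ_[p]),
      a = fun i => ((r i : ℕ) : ℤ_[p]) + (p : ℤ_[p]) ^ m * b i := by
  choose b hb using fun i => Ideal.mem_span_singleton.1 (PadicInt.appr_spec m (a i))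
  exact ⟨fun i => ⟨(a i).appr m, PadicInt.appr_lt _ _⟩, b, funext fun i => by
    rw [← hb]; simp⟩

theorem laNorm_nonneg (m : ℕ) (f : (Fin d → ℤ_[p]) → E) : 0 ≤ laNorm p m d f := by
  unfold laNorm
  split_ifs with h
  · exact Real.iSup_nonneg fun _ => Real.iSup_nonneg fun _ => norm_nonneg _
  · exact le_rfl

theorem IsLA.sub {m : ℕ} {f g : (Fin d → ℤ_[p]) → E} (hf : IsLA p m d f)
    (hg : IsLA p m d g) : IsLA p m d (f - g) := fun a =>
  let ⟨_, hc⟩ := hf.exists_isExpansion a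
  let ⟨_, hc'⟩ := hg.exists_isExpansion a
  ⟨_, hc.sub hc'⟩

theorem IsLA.succ (hA : ∀ z : ℤ_[p], ‖algebraMap ℤ_[p] E z‖ = ‖z‖) {m : ℕ}
    {f : (Fin d → ℤ_[p]) → E} (hf : IsLA p m d f) : IsLA p (m + 1) d f := fun a =>
  let ⟨_, hc⟩ := hf.exists_isExpansion a
  ⟨_, hc.succ hA⟩

variable [IsUltrametricDist E]

theorem HasSum.norm_le_of_forall_le {ι : Type*} {u : ι → E} {s : E} (h : HasSum u s) {C : ℝ}
    (hC : 0 ≤ C) (hu : ∀ i, ‖u i‖ ≤ C) : ‖s‖ ≤ C := by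
  rw [← h.tsum_eq]
  exact norm_tsum_le_of_forall_le_of_nonneg hC hu

/-- A power series vanishing on all of `ℤ_p^d` has zero coefficients. -/
theorem eq_zero_of_PSEval_zero (hA : ∀ z : ℤ_[p], ‖algebraMap ℤ_[p] E z‖ = ‖z‖)
    {c : (Fin d →₀ ℕ) → E} (hc : Tendsto c cofinite (nhds 0))
    (h : ∀ x : Fin d → ℤ_[p], PSEval p c x 0) : c = 0 := by
  obtain ⟨M, hM⟩ := hc.norm.bddAbove_range_of_cofinite
  replace hM : ∀ k, ‖c k‖ ≤ M := fun k => hM ⟨k, rfl⟩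
  have hM0 : 0 ≤ M := (norm_nonneg _).trans (hM 0)
  have hp1 : (1 : ℝ) < p := mod_cast (Fact.out : p.Prime).one_lt
  have hp0 : (0 : ℝ) < (p : ℝ)⁻¹ := by positivity
  have hp1' : (p : ℝ)⁻¹ < 1 := inv_lt_one_of_one_lt₀ hp1
  suffices H : ∀ D : ℕ, ∀ k : Fin d →₀ ℕ, k.degree = D → c k = 0 from
    funext fun k => H _ k rfl
  intro D
  induction D using Nat.strong_induction_on with
  | _ D ih =>
  have hfin : {k : Fin d →₀ ℕ | k.degree = D}.Finite :=
    (Finsupp.finite_of_degree_le D).subset fun k hk => le_of_eq hk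
  set S : Finset (Fin d →₀ ℕ) := hfin.toFinset with hS
  have hmem : ∀ k, k ∈ S ↔ k.degree = D := fun k => by simp [hS]
  have hzero : ∀ x : Fin d → ℤ_[p],
      ∑ k ∈ S, c k * algebraMap ℤ_[p] E (∏ i, x i ^ k i) = 0 := by
    intro x
    set s := ∑ k ∈ S, c k * algebraMap ℤ_[p] E (∏ i, x i ^ k i) with hs
    have hbound : ∀ n : ℕ, ‖s‖ ≤ M * ((p : ℝ)⁻¹) ^ n := by
      intro n
      classical
      set t : E := algebraMap ℤ_[p] E ((p : ℤ_[p]) ^ n) with ht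
      have htn : ‖t‖ = ((p : ℝ)⁻¹) ^ n := norm_algebraMap_p_pow hA n
      have h1 := h (fun i => (p : ℤ_[p]) ^ n * x i)
      unfold PSEval at h1
      simp only [prod_mul_pow_eq, map_mul, map_pow _ ((p : ℤ_[p]) ^ n), ← ht] at h1
      have h2 : HasSum (fun k => if k ∈ S then
          c k * (t ^ k.degree * algebraMap ℤ_[p] E (∏ i, x i ^ k i)) else 0) (t ^ D * s) := by
        have := hasSum_sum_of_ne_finset_zero (L := .unconditional _) (s := S) (f := fun k => if k ∈ S then
          c k * (t ^ k.degree * algebraMap ℤ_[p] E (∏ i, x i ^ k i)) else 0)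
          (fun k hk => by simp [hk])
        convert! this using 1
        rw [hs, Finset.mul_sum]
        refine Finset.sum_congr rfl fun k hk => ?_
        rw [if_pos hk, (hmem k).1 hk]
        ring
      have h3 := (h1.sub h2).norm_le_of_forall_le (C := M * ((p : ℝ)⁻¹ ^ n) ^ (D + 1))
        (by positivity) (fun k => by
          by_cases hk : k ∈ S
          · simp only [hk, if_true, sub_self, norm_zero]
            positivity
          · simp only [hk, if_false, sub_zero]
            rw [hmem] at hk
            rcases lt_or_gt_of_ne hk with hlt | hgt
            · rw [ih _ hlt k rfl]
              simp only [zero_mul, norm_zero]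
              positivity
            · rw [← mul_assoc]
              refine (norm_mul_algebraMap_le hA _ _).trans ?_
              rw [norm_mul, norm_pow, htn]
              refine mul_le_mul (hM k) ?_ (by positivity) hM0
              exact pow_le_pow_of_le_one (by positivity) (pow_le_one₀ hp0.le hp1'.le) hgt)
      rw [zero_sub, norm_neg, norm_mul, norm_pow, htn, pow_succ, mul_left_comm] at h3
      exact le_of_mul_le_mul_left h3 (by positivity)
    have hlim : Tendsto (fun n : ℕ => M * ((p : ℝ)⁻¹) ^ n) atTop (nhds 0) := by
      simpa using (tendsto_pow_atTop_nhds_zero_of_lt_one hp0.le hp1').const_mul M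
    exact norm_le_zero_iff.1 (ge_of_tendsto' hlim hbound)
  have hinj : Function.Injective (algebraMap ℤ_[p] E) := by
    refine (injective_iff_map_eq_zero _).2 fun z hz => ?_
    rw [← norm_eq_zero, ← hA, hz, norm_zero]
  have hpoly : (∑ k ∈ S, MvPolynomial.monomial k (c k)) = 0 := by
    refine MvPolynomial.funext_set (fun _ => Set.range (algebraMap ℤ_[p] E))
      (fun _ => Set.infinite_range_of_injective hinj) fun y hy => ?_
    choose x hx using fun i => hy i (Set.mem_univ i)
    obtain rfl : (fun i => algebraMap ℤ_[p] E (x i)) = y := funext hx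
    have := hzero x
    simp only [map_prod, map_pow] at this
    simpa [map_sum, MvPolynomial.eval_monomial, Finsupp.prod_fintype] using this
  intro k hk
  classical
  have := congrArg (MvPolynomial.coeff k) hpoly
  simpa [MvPolynomial.coeff_sum, MvPolynomial.coeff_monomial, hmem, hk] using this

theorem IsExpansion.unique (hA : ∀ z : ℤ_[p], ‖algebraMap ℤ_[p] E z‖ = ‖z‖) {m : ℕ}
    {f : (Fin d → ℤ_[p]) → E} {a : Fin d → ℤ_[p]} {c c' : (Fin d →₀ ℕ) → E}
    (h : IsExpansion m f a c) (h' : IsExpansion m f a c') : c = c' := by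
  have h0 := h.sub h'
  exact sub_eq_zero.1 (eq_zero_of_PSEval_zero hA h0.1 fun x => by simpa using h0.2 x)

/-- Recentering a convergent power series at another point of the same ball does not increase
its coefficient sup-norm. -/
theorem IsExpansion.exists_recenter [CompleteSpace E]
    (hA : ∀ z : ℤ_[p], ‖algebraMap ℤ_[p] E z‖ = ‖z‖) {m : ℕ}
    {f : (Fin d → ℤ_[p]) → E} {a : Fin d → ℤ_[p]} {c : (Fin d →₀ ℕ) → E}
    (h : IsExpansion m f a c) (b : Fin d → ℤ_[p]) {C : ℝ} (hC : ∀ k, ‖c k‖ ≤ C) :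
    ∃ c', IsExpansion m f (fun i => a i + (p : ℤ_[p]) ^ m * b i) c' ∧ ∀ k, ‖c' k‖ ≤ C := by
  have hC0 : 0 ≤ C := (norm_nonneg _).trans (hC 0)
  let P : (Fin d →₀ ℕ) → MvPolynomial (Fin d) ℤ_[p] := fun k =>
    ∏ i, (MvPolynomial.C (b i) + MvPolynomial.X i) ^ k i
  let F : (Fin d →₀ ℕ) × (Fin d →₀ ℕ) → E := fun q =>
    c q.1 * algebraMap ℤ_[p] E ((P q.1).coeff q.2)
  have hFle : ∀ q, ‖F q‖ ≤ ‖c q.1‖ := fun q => norm_mul_algebraMap_le hA _ _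
  have hF : Tendsto F cofinite (nhds 0) := by
    rw [Metric.tendsto_nhds]
    intro ε hε
    have hK : {k | ¬ dist (c k) 0 < ε}.Finite := (Metric.tendsto_nhds.1 h.1) ε hε
    refine (hK.biUnion (t := fun k => (fun j => (k, j)) '' ((P k).support : Set (Fin d →₀ ℕ)))
      fun k _ => (Finset.finite_toSet _).image _).subset ?_
    rintro ⟨k, j⟩ hq
    simp only [Set.mem_ofPred_eq, Set.mem_compl_iff, dist_zero_right, not_lt] at hq
    refine Set.mem_biUnion (x := k) (by simpa using hq.trans (hFle _)) ⟨j, ?_, rfl⟩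
    rw [Finset.mem_coe, MvPolynomial.mem_support_iff]
    intro h0
    simp only [F, h0, map_zero, mul_zero, norm_zero] at hq
    exact absurd hq (not_le.2 hε)
  have hsum : ∀ y : (Fin d →₀ ℕ) → ℤ_[p],
      Summable fun q => F q * algebraMap ℤ_[p] E (y q.2) := fun y =>
    NonarchimedeanAddGroup.summable_of_tendsto_cofinite_zero
      (squeeze_zero_norm (fun q => norm_mul_algebraMap_le hA _ _) (by simpa using hF.norm))
  have hcol : ∀ j, HasSum (fun k => F (k, j)) (∑' k, F (k, j)) := fun j =>
    (NonarchimedeanAddGroup.summable_of_tendsto_cofinite_zero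
      (hF.comp (Prod.mk_left_injective j).tendsto_cofinite)).hasSum
  refine ⟨fun j => ∑' k, F (k, j), ⟨?_, fun x => ?_⟩, fun j =>
    (hcol j).norm_le_of_forall_le hC0 fun k => (hFle _).trans (hC k)⟩
  · rw [Metric.tendsto_nhds]
    intro ε hε
    have hK : {q | ¬ dist (F q) 0 < ε / 2}.Finite := (Metric.tendsto_nhds.1 hF) _ (half_pos hε)
    refine (hK.image Prod.snd).subset fun j hj => ?_
    by_contra hcon
    refine hj ?_
    rw [Set.mem_ofPred_eq, dist_zero_right]
    refine ((hcol j).norm_le_of_forall_le (half_pos hε).le fun k => ?_).trans_lt (half_lt_self hε)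
    by_contra hk
    exact hcon ⟨(k, j), by simpa using (not_le.1 hk).le, rfl⟩
  · set y : (Fin d →₀ ℕ) → ℤ_[p] := fun j => ∏ i, x i ^ j i with hy
    have hrow : ∀ k, HasSum (fun j => F (k, j) * algebraMap ℤ_[p] E (y j))
        (c k * algebraMap ℤ_[p] E (∏ i, (b i + x i) ^ k i)) := by
      intro k
      have h1 : ∏ i, (b i + x i) ^ k i = MvPolynomial.eval x (P k) := by simp [P]
      rw [h1, MvPolynomial.eval_eq', map_sum, Finset.mul_sum]
      have := hasSum_sum_of_ne_finset_zero (L := .unconditional _) (s := (P k).support)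
        (f := fun j => F (k, j) * algebraMap ℤ_[p] E (y j)) (fun j hj => by
          simp [F, MvPolynomial.notMem_support_iff.1 hj])
      simpa [F, hy, mul_assoc] using this
    have htot := (hsum y).hasSum
    have hval := (htot.prod_fiberwise hrow).unique (h.2 fun i => b i + x i)
    rw [hval] at htot
    have hswap := (Equiv.prodComm _ _).hasSum_iff.2 htot
    have := hswap.prod_fiberwise fun j => (hcol j).mul_right (algebraMap ℤ_[p] E (y j))
    simpa only [PSEval, hy, mul_add, add_assoc] using this

/-- It suffices to bound the coefficients of the expansions at the coset representatives. -/
theorem laNorm_le_of_representatives (hA : ∀ z : ℤ_[p], ‖algebraMap ℤ_[p] E z‖ = ‖z‖) {m : ℕ}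
    {f : (Fin d → ℤ_[p]) → E} (hf : IsLA p m d f) {C : ℝ} (hC : 0 ≤ C)
    (h : ∀ r : Fin d → Fin (p ^ m), ∃ c,
      IsExpansion m f (fun i => ((r i : ℕ) : ℤ_[p])) c ∧ ∀ k, ‖c k‖ ≤ C) :
    laNorm p m d f ≤ C := by
  rw [laNorm, dif_pos hf]
  refine Real.iSup_le (fun r => Real.iSup_le (fun k => ?_) hC) hC
  obtain ⟨c, hc, hcC⟩ := h r
  have hch : IsExpansion m f _ _ := Classical.choose_spec (hf fun i => ((r i : ℕ) : ℤ_[p]))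
  rw [hch.unique hA hc]
  exact hcC k

theorem laNorm_le (hA : ∀ z : ℤ_[p], ‖algebraMap ℤ_[p] E z‖ = ‖z‖) {m : ℕ}
    {f : (Fin d → ℤ_[p]) → E} {C : ℝ} (hC : 0 ≤ C)
    (h : ∀ a, ∃ c, IsExpansion m f a c ∧ ∀ k, ‖c k‖ ≤ C) : laNorm p m d f ≤ C :=
  laNorm_le_of_representatives hA (fun a => (h a).imp fun _ h => h.1) hC fun _ => h _

theorem IsExpansion.norm_le_laNorm [CompleteSpace E]
    (hA : ∀ z : ℤ_[p], ‖algebraMap ℤ_[p] E z‖ = ‖z‖) {m : ℕ}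
    {f : (Fin d → ℤ_[p]) → E} (hf : IsLA p m d f) {a : Fin d → ℤ_[p]}
    {c : (Fin d →₀ ℕ) → E} (h : IsExpansion m f a c) (k : Fin d →₀ ℕ) :
    ‖c k‖ ≤ laNorm p m d f := by
  obtain ⟨r, b, rfl⟩ := exists_eq_natCast_add m a
  have hch : IsExpansion m f _ _ := Classical.choose_spec (hf fun i => ((r i : ℕ) : ℤ_[p]))
  obtain ⟨c', hc', hle⟩ := hch.exists_recenter hA b (C := laNorm p m d f) (fun k => by
    rw [laNorm, dif_pos hf]
    exact (le_ciSup hch.bddAbove k).trans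
      (le_ciSup (f := fun r : Fin d → Fin (p ^ m) => ⨆ k : Fin d →₀ ℕ,
        ‖(Classical.choose (hf fun i => ((r i : ℕ) : ℤ_[p]))) k‖) (Set.finite_range _).bddAbove r))
  rw [h.unique hA hc']
  exact hle k

theorem norm_apply_le_laNorm [CompleteSpace E]
    (hA : ∀ z : ℤ_[p], ‖algebraMap ℤ_[p] E z‖ = ‖z‖) {m : ℕ}
    {f : (Fin d → ℤ_[p]) → E} (hf : IsLA p m d f) (a : Fin d → ℤ_[p]) :
    ‖f a‖ ≤ laNorm p m d f := by
  obtain ⟨c, hc⟩ := hf.exists_isExpansion a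
  rw [hc.apply_center]
  exact hc.norm_le_laNorm hA hf 0

theorem laNorm_eq_zero_iff [CompleteSpace E]
    (hA : ∀ z : ℤ_[p], ‖algebraMap ℤ_[p] E z‖ = ‖z‖) {m : ℕ}
    {f : (Fin d → ℤ_[p]) → E} (hf : IsLA p m d f) : laNorm p m d f = 0 ↔ f = 0 := by
  constructor
  · intro h
    funext a
    exact norm_le_zero_iff.1 (h ▸ norm_apply_le_laNorm hA hf a)
  · rintro rfl
    refine le_antisymm (laNorm_le hA le_rfl fun a => ⟨0, ⟨tendsto_const_nhds, fun x => ?_⟩, ?_⟩)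
      (laNorm_nonneg _ _)
    · simp [PSEval]
    · simp

theorem laNorm_smul_le [CompleteSpace E]
    (hA : ∀ z : ℤ_[p], ‖algebraMap ℤ_[p] E z‖ = ‖z‖) {m : ℕ} (r : E)
    {f : (Fin d → ℤ_[p]) → E} (hf : IsLA p m d f) :
    laNorm p m d (r • f) ≤ ‖r‖ * laNorm p m d f := by
  refine laNorm_le hA (mul_nonneg (norm_nonneg _) (laNorm_nonneg _ _)) fun a => ?_
  obtain ⟨c, hc⟩ := hf.exists_isExpansion a
  refine ⟨_, hc.smul r, fun k => ?_⟩
  rw [Pi.smul_apply, norm_smul]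
  exact mul_le_mul_of_nonneg_left (hc.norm_le_laNorm hA hf k) (norm_nonneg _)

theorem laNorm_smul [CompleteSpace E]
    (hA : ∀ z : ℤ_[p], ‖algebraMap ℤ_[p] E z‖ = ‖z‖) {m : ℕ} (r : E)
    {f : (Fin d → ℤ_[p]) → E} (hf : IsLA p m d f) :
    laNorm p m d (r • f) = ‖r‖ * laNorm p m d f := by
  have hrf : IsLA p m d (r • f) := fun a => (hf.exists_isExpansion a).imp' _ fun c hc => hc.smul r
  rcases eq_or_ne r 0 with rfl | hr
  · rw [(laNorm_eq_zero_iff hA hrf).2 (zero_smul _ _), norm_zero, zero_mul]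
  refine (laNorm_smul_le hA r hf).antisymm ?_
  have := laNorm_smul_le hA r⁻¹ hrf
  rwa [inv_smul_smul₀ hr, norm_inv, inv_mul_eq_div, le_div_iff₀' (norm_pos_iff.2 hr)] at this

theorem laNorm_add_le [CompleteSpace E]
    (hA : ∀ z : ℤ_[p], ‖algebraMap ℤ_[p] E z‖ = ‖z‖) {m : ℕ}
    {f g : (Fin d → ℤ_[p]) → E} (hf : IsLA p m d f) (hg : IsLA p m d g) :
    laNorm p m d (f + g) ≤ laNorm p m d f + laNorm p m d g := by
  refine laNorm_le hA (add_nonneg (laNorm_nonneg _ _) (laNorm_nonneg _ _)) fun a => ?_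
  obtain ⟨c, hc⟩ := hf.exists_isExpansion a
  obtain ⟨c', hc'⟩ := hg.exists_isExpansion a
  exact ⟨_, hc.add hc', fun k => (norm_add_le _ _).trans
    (add_le_add (hc.norm_le_laNorm hA hf k) (hc'.norm_le_laNorm hA hg k))⟩

/-- A uniform limit of expansions is the expansion of the pointwise limit. -/
theorem IsExpansion.of_uniform_limit [CompleteSpace E]
    (hA : ∀ z : ℤ_[p], ‖algebraMap ℤ_[p] E z‖ = ‖z‖) {m : ℕ}
    {u : ℕ → (Fin d → ℤ_[p]) → E} {f : (Fin d → ℤ_[p]) → E} {a : Fin d → ℤ_[p]}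
    {c : ℕ → (Fin d →₀ ℕ) → E} {l : (Fin d →₀ ℕ) → E} (hc : ∀ i, IsExpansion m (u i) a (c i))
    (hu : ∀ y, Tendsto (fun i => u i y) atTop (nhds (f y)))
    (hl : ∀ ε : ℝ, 0 < ε → ∃ N, ∀ i, N ≤ i → ∀ k, ‖c i k - l k‖ ≤ ε) :
    IsExpansion m f a l := by
  have hl0 : Tendsto l cofinite (nhds 0) := by
    rw [Metric.tendsto_nhds]
    intro ε hε
    obtain ⟨N, hN⟩ := hl (ε / 2) (half_pos hε)
    filter_upwards [(Metric.tendsto_nhds.1 (hc N).1) (ε / 2) (half_pos hε)] with k hk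
    rw [dist_zero_right] at hk ⊢
    calc ‖l k‖ = ‖c N k - (c N k - l k)‖ := by rw [sub_sub_cancel]
      _ ≤ ‖c N k‖ + ‖c N k - l k‖ := norm_sub_le _ _
      _ < ε := by linarith [hN N le_rfl k]
  refine ⟨hl0, fun x => ?_⟩
  set y : Fin d → ℤ_[p] := fun i => a i + (p : ℤ_[p]) ^ m * x i
  have hs : HasSum (fun k => l k * algebraMap ℤ_[p] E (∏ i, x i ^ k i)) _ :=
    (NonarchimedeanAddGroup.summable_of_tendsto_cofinite_zero
      (squeeze_zero_norm (fun k => norm_mul_algebraMap_le hA _ _)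
        (by simpa using hl0.norm))).hasSum
  have hlim : Tendsto (fun i => u i y) atTop
      (nhds (∑' k, l k * algebraMap ℤ_[p] E (∏ i, x i ^ k i))) := by
    rw [Metric.tendsto_atTop]
    intro ε hε
    obtain ⟨N, hN⟩ := hl (ε / 2) (half_pos hε)
    refine ⟨N, fun i hi => ?_⟩
    rw [dist_eq_norm]
    refine (((hc i).2 x).sub hs |>.norm_le_of_forall_le (half_pos hε).le fun k => ?_).trans_lt
      (half_lt_self hε)
    rw [← sub_mul]
    exact (norm_mul_algebraMap_le hA _ _).trans (hN i hi k)
  rw [tendsto_nhds_unique hlim (hu y)] at hs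
  exact hs

theorem exists_tendsto_of_laNorm_cauchy [CompleteSpace E]
    (hA : ∀ z : ℤ_[p], ‖algebraMap ℤ_[p] E z‖ = ‖z‖) {m : ℕ}
    {u : ℕ → (Fin d → ℤ_[p]) → E} (hu : ∀ i, IsLA p m d (u i))
    (hcau : ∀ ε : ℝ, 0 < ε → ∃ N : ℕ, ∀ i j : ℕ, N ≤ i → N ≤ j →
      laNorm p m d (u i - u j) < ε) :
    ∃ f : (Fin d → ℤ_[p]) → E, IsLA p m d f ∧
      Tendsto (fun i => laNorm p m d (u i - f)) atTop (nhds 0) := by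
  choose c hc using fun i a => (hu i).exists_isExpansion a
  have hcle : ∀ i j a k, ‖c i a k - c j a k‖ ≤ laNorm p m d (u i - u j) := fun i j a k =>
    ((hc i a).sub (hc j a)).norm_le_laNorm hA ((hu i).sub (hu j)) k
  have hlim : ∀ a k, ∃ l, Tendsto (fun i => c i a k) atTop (nhds l) := fun a k =>
    cauchySeq_tendsto_of_complete <| Metric.cauchySeq_iff.2 fun ε hε =>
      (hcau ε hε).imp fun N hN i hi j hj => by
        rw [dist_eq_norm]
        exact (hcle i j a k).trans_lt (hN i j hi hj)
  choose l hl using hlim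
  have hunif : ∀ ε : ℝ, 0 < ε → ∃ N, ∀ i, N ≤ i → ∀ a k, ‖c i a k - l a k‖ ≤ ε := by
    intro ε hε
    obtain ⟨N, hN⟩ := hcau ε hε
    refine ⟨N, fun i hi a k => ?_⟩
    refine le_of_tendsto (tendsto_const_nhds.sub (hl a k)).norm ?_
    filter_upwards [eventually_ge_atTop N] with j hj
    exact (hcle i j a k).trans (hN i j hi hj).le
  have hexp : ∀ a, IsExpansion m (fun y => l y 0) a (l a) := fun a =>
    IsExpansion.of_uniform_limit hA (fun i => hc i a)
      (fun y => by simpa only [(hc _ y).apply_center] using hl y 0)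
      fun ε hε => (hunif ε hε).imp fun N hN i hi k => hN i hi a k
  refine ⟨_, isLA_of_isExpansion hexp, ?_⟩
  rw [Metric.tendsto_atTop]
  intro ε hε
  obtain ⟨N, hN⟩ := hunif (ε / 2) (half_pos hε)
  refine ⟨N, fun i hi => ?_⟩
  rw [Real.dist_0_eq_abs, abs_of_nonneg (laNorm_nonneg _ _)]
  exact (laNorm_le hA (half_pos hε).le fun a =>
    ⟨_, (hc i a).sub (hexp a), hN i hi a⟩).trans_lt (half_lt_self hε)

/-- The unit ball of `LA_m` is totally bounded in `LA_{m+1}`. -/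
theorem exists_finset_laNorm_succ_le [ProperSpace E]
    (hA : ∀ z : ℤ_[p], ‖algebraMap ℤ_[p] E z‖ = ‖z‖) (m d : ℕ) {ε : ℝ} (hε : 0 < ε) :
    ∃ s : Finset ((Fin d → ℤ_[p]) → E), (∀ g ∈ s, IsLA p (m + 1) d g) ∧
      ∀ f : (Fin d → ℤ_[p]) → E, IsLA p m d f → laNorm p m d f ≤ 1 →
        ∃ g ∈ s, laNorm p (m + 1) d (f - g) ≤ ε := by
  classical
  have hp1 : (1 : ℝ) < p := mod_cast (Fact.out : p.Prime).one_lt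
  have hp0 : (0 : ℝ) ≤ (p : ℝ)⁻¹ := by positivity
  have hp1' : (p : ℝ)⁻¹ < 1 := inv_lt_one_of_one_lt₀ hp1
  obtain ⟨D, hD⟩ := exists_pow_lt_of_lt_one hε hp1'
  let B := {f : (Fin d → ℤ_[p]) → E // IsLA p m d f ∧ laNorm p m d f ≤ 1}
  rcases isEmpty_or_nonempty B with hB | hB
  · exact ⟨∅, by simp, fun f hf hf1 => (hB.false ⟨f, hf, hf1⟩).elim⟩
  choose c hc using fun (f : B) a => f.2.1.exists_isExpansion a
  have hc1 : ∀ f a k, ‖c f a k‖ ≤ 1 := fun f a k =>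
    ((hc f a).norm_le_laNorm hA f.2.1 k).trans f.2.2
  let K := (Finsupp.finite_of_degree_le (σ := Fin d) D).toFinset
  let Φ : B → (Fin d → Fin (p ^ (m + 1))) × K → E := fun f q =>
    c f (fun i => ((q.1 i : ℕ) : ℤ_[p])) q.2
  have htb : TotallyBounded (Set.range Φ) := by
    refine (isCompact_closedBall (0 : (Fin d → Fin (p ^ (m + 1))) × K → E)
      1).totallyBounded.subset ?_
    rintro _ ⟨f, rfl⟩
    rw [mem_closedBall_zero_iff]
    exact (pi_norm_le_iff_of_nonneg zero_le_one).2 fun q => hc1 _ _ _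
  obtain ⟨t, htsub, htfin, ht⟩ := Metric.finite_approx_of_totallyBounded htb ε hε
  choose! w hw using fun y (hy : y ∈ t) => htsub hy
  refine ⟨htfin.toFinset.image fun y => (w y).1, ?_, fun f hf hf1 => ?_⟩
  · intro g hg
    obtain ⟨y, -, rfl⟩ := Finset.mem_image.1 hg
    exact (w y).2.1.succ hA
  obtain ⟨y, hy, hfy⟩ := Set.mem_iUnion₂.1 (ht ⟨⟨f, hf, hf1⟩, rfl⟩)
  refine ⟨(w y).1, Finset.mem_image_of_mem _ (htfin.mem_toFinset.2 hy), ?_⟩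
  set F : B := ⟨f, hf, hf1⟩
  rw [← hw y hy, Metric.mem_ball, dist_eq_norm] at hfy
  refine laNorm_le_of_representatives hA ((hf.sub (w y).2.1).succ hA) hε.le fun r => ?_
  refine ⟨_, ((hc F _).sub (hc (w y) _)).succ hA, fun k => ?_⟩
  by_cases hk : k.degree ≤ D
  · refine (norm_mul_algebraMap_le hA _ _).trans ?_
    exact (norm_le_pi_norm (Φ F - Φ (w y)) (r, ⟨k, by simpa [K] using hk⟩)).trans hfy.le
  · rw [norm_mul, norm_algebraMap_p_pow hA]
    have h1 : ‖(c F (fun i => ((r i : ℕ) : ℤ_[p])) - c (w y) (fun i => ((r i : ℕ) : ℤ_[p]))) k‖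
        ≤ 1 := by
      rw [Pi.sub_apply, sub_eq_add_neg]
      exact (norm_add_le_max _ _).trans (max_le (hc1 _ _ _) (by rw [norm_neg]; exact hc1 _ _ _))
    calc _ ≤ 1 * ((p : ℝ)⁻¹) ^ k.degree := by gcongr
      _ ≤ ((p : ℝ)⁻¹) ^ D := by
        rw [one_mul]
        exact pow_le_pow_of_le_one hp0 hp1'.le (not_le.1 hk).le
      _ ≤ ε := hD.le

end

/-- Let `E` be a finite extension of `ℚ_p`.  For each `m ≥ 0`,
`LA_m(ℤ_p^d, E)` equipped with the coefficient sup-norm `‖f‖ = sup_{a,k} |c_{a,k}|` is an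
`E`-Banach space, and the natural inclusion `LA_m(ℤ_p^d, E) → LA_{m+1}(ℤ_p^d, E)` is a
compact operator of `E`-Banach spaces (the image of the unit ball is totally bounded). -/
theorem LA_banach_and_inclusion_compact
    (p : ℕ) [Fact p.Prime] (E : Type*) [NontriviallyNormedField E] [CompleteSpace E]
    [Algebra ℚ_[p] E] [FiniteDimensional ℚ_[p] E]
    (hiso : ∀ x : ℚ_[p], ‖algebraMap ℚ_[p] E x‖ = ‖x‖)
    (hna : IsNonarchimedean (fun x : E => ‖x‖))
    [Algebra ℤ_[p] E] [IsScalarTower ℤ_[p] ℚ_[p] E]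
    (m : ℕ) {d : ℕ} (hd : 1 ≤ d) :
    -- the natural inclusion `LA_m ⊆ LA_{m+1}`
    (∀ f : (Fin d → ℤ_[p]) → E, IsLA p m d f → IsLA p (m + 1) d f) ∧
    -- `laNorm` is a norm:
    (∀ f : (Fin d → ℤ_[p]) → E, IsLA p m d f → (laNorm p m d f = 0 ↔ f = 0)) ∧
    (∀ (r : E) (f : (Fin d → ℤ_[p]) → E), IsLA p m d f →
      laNorm p m d (r • f) = ‖r‖ * laNorm p m d f) ∧
    (∀ f g : (Fin d → ℤ_[p]) → E, IsLA p m d f → IsLA p m d g →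
      laNorm p m d (f + g) ≤ laNorm p m d f + laNorm p m d g) ∧
    -- completeness: every Cauchy sequence converges
    (∀ u : ℕ → ((Fin d → ℤ_[p]) → E), (∀ i, IsLA p m d (u i)) →
      (∀ ε : ℝ, 0 < ε → ∃ N : ℕ, ∀ i j : ℕ, N ≤ i → N ≤ j →
        laNorm p m d (u i - u j) < ε) →
      ∃ f : (Fin d → ℤ_[p]) → E, IsLA p m d f ∧
        Filter.Tendsto (fun i => laNorm p m d (u i - f)) Filter.atTop (nhds 0)) ∧
    -- compactness of the inclusion: the image of the unit ball is totally bounded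
    (∀ ε : ℝ, 0 < ε → ∃ s : Finset ((Fin d → ℤ_[p]) → E),
      (∀ g ∈ s, IsLA p (m + 1) d g) ∧
      ∀ f : (Fin d → ℤ_[p]) → E, IsLA p m d f → laNorm p m d f ≤ 1 →
        ∃ g ∈ s, laNorm p (m + 1) d (f - g) ≤ ε) := by
  have hA : ∀ z : ℤ_[p], ‖algebraMap ℤ_[p] E z‖ = ‖z‖ := fun z => by
    rw [IsScalarTower.algebraMap_apply ℤ_[p] ℚ_[p] E, hiso]
    rfl
  have : IsUltrametricDist E := isUltrametricDist_of_isNonarchimedean_norm hna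
  let : NormedSpace ℚ_[p] E :=
    { (inferInstance : Module ℚ_[p] E) with
      norm_smul_le := fun r x => by rw [Algebra.smul_def, norm_mul, hiso] }
  have : ProperSpace E := FiniteDimensional.proper ℚ_[p] E
  exact ⟨fun f hf => hf.succ hA, fun f hf => laNorm_eq_zero_iff hA hf,
    fun r f hf => laNorm_smul hA r hf, fun f g hf hg => laNorm_add_le hA hf hg,
    fun u hu hcau => exists_tendsto_of_laNorm_cauchy hA hu hcau,
    fun ε hε => exists_finset_laNorm_succ_le hA m d hε⟩
end

section
/- Let M be an R-module with an R-linear endomorphism u and h ∈ Q. If M admits a slope ≤ h decomposition with respect to u, then this decomposition is unique (i.e. the submodules M^{u≤h} and M^{u>h} are uniquely determined), and u restricts to an automorphism of M^{u≤h}. -/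
/-!
Slope `≤ h` decompositions with respect to a compact operator, following
Ash–Stevens/Urban/Hansen.  `R` is a commutative Banach algebra over `ℚ_p` with
`‖p ⬝ r‖ = p⁻¹ ‖r‖`; the valuation `v(r) = -log_p ‖r‖` condition
`v(c_i) ≥ v(c_n) - h (n - i)` is expressed multiplicatively as
`‖c_i‖ ≤ ‖c_n‖ ⬝ p^(h (n - i))`.
-/

/-- A polynomial `Q(t) = Σ c_i t^i ∈ R[t]` with `c_0 = 1` and invertible leading
coefficient has slope `≤ h` if `v(c_i) ≥ v(c_n) - h (n - i)` for all `0 ≤ i ≤ n`,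
where `v = -log_p ‖·‖`. -/
def SlopeLePoly {R : Type*} [NormedCommRing R] (p : ℕ) (h : ℚ) (Q : Polynomial R) : Prop :=
  Q.coeff 0 = 1 ∧ IsUnit Q.leadingCoeff ∧
    ∀ i ≤ Q.natDegree,
      ‖Q.coeff i‖ ≤ ‖Q.leadingCoeff‖ * (p : ℝ) ^ ((h : ℝ) * ((Q.natDegree : ℝ) - (i : ℝ)))

/-- `Q*(u)` where `Q*(t) = t^n Q(1/t)` is the reversed polynomial, evaluated at the
`R`-linear endomorphism `u`. -/
noncomputable def QstarEval {R : Type*} [CommRing R] {M : Type*} [AddCommGroup M] [Module R M]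
    (u : Module.End R M) (Q : Polynomial R) : Module.End R M :=
  Polynomial.aeval u Q.reverse

/-- A slope `≤ h` decomposition of `M` with respect to `u`: a direct sum decomposition
`M = M^{u ≤ h} ⊕ M^{u > h}` into `u`-stable submodules such that `M^{u ≤ h}` is finitely
generated, every element of `M^{u ≤ h}` is killed by `Q*(u)` for some slope `≤ h`
polynomial `Q` (with `Q*(0)` a multiplicative unit), and `Q*(u)` is an isomorphism of
`M^{u > h}` for every such `Q`. -/
structure IsSlopeLeDecomp {R : Type*} [NormedCommRing R] {M : Type*} [AddCommGroup M]
    [Module R M] (p : ℕ) (h : ℚ) (u : Module.End R M) (Mle Mgt : Submodule R M) : Prop where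
  isCompl : IsCompl Mle Mgt
  le_stable : ∀ m ∈ Mle, u m ∈ Mle
  gt_stable : ∀ m ∈ Mgt, u m ∈ Mgt
  fg : Mle.FG
  ann : ∀ m ∈ Mle, ∃ Q : Polynomial R, SlopeLePoly p h Q ∧ QstarEval u Q m = 0
  equiv_gt : ∀ Q : Polynomial R, SlopeLePoly p h Q →
    (∀ m ∈ Mgt, QstarEval u Q m ∈ Mgt) ∧
    (∀ m ∈ Mgt, QstarEval u Q m = 0 → m = 0) ∧
    (∀ y ∈ Mgt, ∃ m ∈ Mgt, QstarEval u Q m = y)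

namespace IsSlopeLeDecomp

variable {p : ℕ} {R : Type*} [NormedCommRing R] {M : Type*} [AddCommGroup M] [Module R M]
  {u : Module.End R M} {h : ℚ} {Mle Mgt Mle' Mgt' : Submodule R M}

/-- Separating the invertible constant term of `Q*` in the relation `Q*(u) m = 0`. -/
theorem exists_unit_smul_add_aeval_eq_zero (H : IsSlopeLeDecomp p h u Mle Mgt) {m : M}
    (hm : m ∈ Mle) :
    ∃ c : Rˣ, ∃ q : Polynomial R, Polynomial.aeval u q (u m) + (c : R) • m = 0 := by
  obtain ⟨Q, ⟨-, ⟨c, hc⟩, -⟩, hQ⟩ := H.ann m hm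
  refine ⟨c, Q.reverse.divX, ?_⟩
  rw [QstarEval, ← Polynomial.divX_mul_X_add Q.reverse, Polynomial.coeff_zero_reverse, ← hc] at hQ
  simpa [Module.algebraMap_end_apply] using hQ

theorem aeval_mem_le (H : IsSlopeLeDecomp p h u Mle Mgt) (q : Polynomial R) {m : M}
    (hm : m ∈ Mle) : Polynomial.aeval u q m ∈ Mle :=
  Polynomial.aeval_apply_smul_mem_of_le_comap hm q u H.le_stable

theorem eq_zero_of_apply_eq_zero (H : IsSlopeLeDecomp p h u Mle Mgt) {m : M} (hm : m ∈ Mle)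
    (hu : u m = 0) : m = 0 := by
  obtain ⟨c, q, hq⟩ := H.exists_unit_smul_add_aeval_eq_zero hm
  rw [hu, map_zero, zero_add] at hq
  exact (smul_eq_zero_iff_eq c).mp hq

theorem exists_apply_eq (H : IsSlopeLeDecomp p h u Mle Mgt) {y : M} (hy : y ∈ Mle) :
    ∃ m ∈ Mle, u m = y := by
  obtain ⟨c, q, hq⟩ := H.exists_unit_smul_add_aeval_eq_zero hy
  refine ⟨-((↑c⁻¹ : R) • Polynomial.aeval u q y),
    Mle.neg_mem (Mle.smul_mem _ (H.aeval_mem_le q hy)), ?_⟩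
  have hcomm : u (Polynomial.aeval u q y) = Polynomial.aeval u q (u y) := by
    simpa using congrArg (fun f => Polynomial.aeval u f y) (mul_comm Polynomial.X q)
  rw [map_neg, map_smul, hcomm, eq_neg_of_add_eq_zero_left hq, smul_neg, neg_neg, smul_smul,
    Units.inv_mul, one_smul]

theorem le_le (H : IsSlopeLeDecomp p h u Mle Mgt) (H' : IsSlopeLeDecomp p h u Mle' Mgt') :
    Mle ≤ Mle' := by
  intro m hm
  obtain ⟨Q, hQ, hQm⟩ := H.ann m hm
  obtain ⟨a, ha, b, hb, rfl⟩ := Submodule.mem_sup.mp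
    (H'.isCompl.sup_eq_top ▸ Submodule.mem_top : m ∈ Mle' ⊔ Mgt')
  obtain ⟨hstable, hinj, -⟩ := H'.equiv_gt Q hQ
  rw [map_add] at hQm
  have hQb : QstarEval u Q b ∈ Mle' :=
    eq_neg_of_add_eq_zero_right hQm ▸ Mle'.neg_mem (H'.aeval_mem_le _ ha)
  rw [hinj b hb (Submodule.disjoint_def.mp H'.isCompl.disjoint _ hQb (hstable b hb)), add_zero]
  exact ha

/-- The submonoid of endomorphisms generated by the `Q*(u)` for `Q` of slope `≤ h`. -/
def starMonoid (p : ℕ) (h : ℚ) (u : Module.End R M) : Submonoid (Module.End R M) :=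
  Submonoid.closure {f | ∃ Q, SlopeLePoly p h Q ∧ QstarEval u Q = f}

theorem map_gt_eq (H : IsSlopeLeDecomp p h u Mle Mgt) {f : Module.End R M}
    (hf : f ∈ starMonoid p h u) : Mgt.map f = Mgt := by
  induction hf using Submonoid.closure_induction with
  | mem f hf =>
    obtain ⟨Q, hQ, rfl⟩ := hf
    obtain ⟨hstable, -, hsurj⟩ := H.equiv_gt Q hQ
    exact le_antisymm (Submodule.map_le_iff_le_comap.mpr hstable) hsurj
  | one => exact Submodule.map_id Mgt
  | mul f g _ _ hf hg => rw [Module.End.mul_eq_comp, Submodule.map_comp, hg, hf]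

theorem commute_of_mem_starMonoid {f g : Module.End R M} (hf : f ∈ starMonoid p h u)
    (hg : g ∈ starMonoid p h u) : Commute f g := by
  have hle : starMonoid p h u ≤ (Polynomial.aeval (R := R) u).range.toSubmonoid := by
    rw [starMonoid, Submonoid.closure_le]
    rintro _ ⟨Q, -, rfl⟩
    exact ⟨Q.reverse, rfl⟩
  obtain ⟨a, rfl⟩ := hle hf
  obtain ⟨b, rfl⟩ := hle hg
  exact (Commute.all a b).map (Polynomial.aeval (R := R) u)

theorem exists_mem_starMonoid_le_ker (H : IsSlopeLeDecomp p h u Mle Mgt) :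
    ∃ f ∈ starMonoid p h u, Mle ≤ LinearMap.ker f := by
  classical
  obtain ⟨S, hS⟩ := H.fg
  suffices hfin : ∀ T : Finset M, (T : Set M) ⊆ Mle →
      ∃ f ∈ starMonoid p h u, ∀ m ∈ T, f m = 0 by
    obtain ⟨f, hf, hker⟩ := hfin S (hS ▸ Submodule.subset_span)
    exact ⟨f, hf, hS ▸ Submodule.span_le.mpr hker⟩
  intro T
  induction T using Finset.induction_on with
  | empty => exact fun _ => ⟨1, one_mem _, by simp⟩
  | insert a T _ ih =>
    intro hT
    rw [Finset.coe_insert, Set.insert_subset_iff] at hT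
    obtain ⟨f, hf, hfT⟩ := ih hT.2
    obtain ⟨Q, hQ, hQa⟩ := H.ann a hT.1
    have hg : QstarEval u Q ∈ starMonoid p h u := Submonoid.subset_closure ⟨Q, hQ, rfl⟩
    refine ⟨f * QstarEval u Q, mul_mem hf hg, fun m hm => ?_⟩
    rcases Finset.mem_insert.mp hm with rfl | hm
    · rw [Module.End.mul_apply, hQa, map_zero]
    · rw [(commute_of_mem_starMonoid hf hg).eq, Module.End.mul_apply, hfT m hm, map_zero]

theorem gt_le (H : IsSlopeLeDecomp p h u Mle Mgt) (H' : IsSlopeLeDecomp p h u Mle' Mgt') :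
    Mgt ≤ Mgt' := by
  obtain ⟨f, hf, hker⟩ := H'.exists_mem_starMonoid_le_ker
  calc Mgt = Mgt.map f := (H.map_gt_eq hf).symm
    _ ≤ (Mle' ⊔ Mgt').map f := Submodule.map_mono (H'.isCompl.sup_eq_top ▸ le_top)
    _ = Mgt' := by
      rw [Submodule.map_sup, H'.map_gt_eq hf, (LinearMap.le_ker_iff_map (f := f)).mp hker,
        bot_sup_eq]

end IsSlopeLeDecomp

/-- Let `R` be a commutative Banach algebra over `ℚ_p` (with
`‖p r‖ = p⁻¹ ‖r‖`), `M` an `R`-module with an `R`-linear endomorphism `u`, and `h ∈ ℚ`.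
If `M` admits a slope `≤ h` decomposition with respect to `u`, then this decomposition is
unique (the submodules `M^{u ≤ h}` and `M^{u > h}` are uniquely determined) and `u`
restricts to an automorphism of `M^{u ≤ h}`. -/
theorem slopeLeDecomp_unique_and_u_automorphism
    (p : ℕ) [Fact p.Prime] {R : Type*} [NormedCommRing R] [NormedAlgebra ℚ_[p] R]
    [CompleteSpace R] (hpnorm : ∀ r : R, ‖(p : R) * r‖ = (p : ℝ)⁻¹ * ‖r‖)
    {M : Type*} [AddCommGroup M] [Module R M] (u : Module.End R M) (h : ℚ)
    {Mle Mgt Mle' Mgt' : Submodule R M}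
    (H : IsSlopeLeDecomp p h u Mle Mgt) (H' : IsSlopeLeDecomp p h u Mle' Mgt') :
    (Mle = Mle' ∧ Mgt = Mgt') ∧
    (∀ m ∈ Mle, u m ∈ Mle) ∧
    (∀ m ∈ Mle, u m = 0 → m = 0) ∧
    (∀ y ∈ Mle, ∃ m ∈ Mle, u m = y) := by
  exact ⟨⟨le_antisymm (H.le_le H') (H'.le_le H), le_antisymm (H.gt_le H') (H'.gt_le H)⟩,
    H.le_stable, fun _ => H.eq_zero_of_apply_eq_zero, fun _ => H.exists_apply_eq⟩
end

section
/- Let M be an R-module admitting a slope ≤ h decomposition M = M^{u≤h} ⊕ M^{u>h} with respect to an R-linear endomorphism u. If m ∈ M satisfies Q*(u)m = 0 for some slope ≤ h polynomial Q ∈ R[t] with Q*(0) a multiplicative unit in R, then m ∈ M^{u≤h}. Consequently, any R-linear endomorphism of M commuting with u preserves M^{u≤h}. -/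
/-- The operator `Q*(u)` preserves every `u`-stable submodule. -/
lemma QstarEval_mem {R : Type*} [CommRing R] {M : Type*} [AddCommGroup M] [Module R M]
    {u : Module.End R M} {N : Submodule R M} (hN : ∀ m ∈ N, u m ∈ N) (Q : Polynomial R)
    {m : M} (hm : m ∈ N) : QstarEval u Q m ∈ N := by
  exact Polynomial.aeval_apply_smul_mem_of_le_comap' hm Q.reverse u hN

/-- Endomorphisms commuting with `u` commute with `Q*(u)`. -/
lemma QstarEval_apply_comm {R : Type*} [CommRing R] {M : Type*} [AddCommGroup M] [Module R M]
    {u φ : Module.End R M} (hφ : Commute φ u) (Q : Polynomial R) (m : M) :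
    QstarEval u Q (φ m) = φ (QstarEval u Q m) :=
  (LinearMap.congr_fun (Algebra.commute_of_mem_adjoin_singleton_of_commute
    (Polynomial.aeval_mem_adjoin_singleton R u) hφ).eq m).symm

/-- Elements killed by `Q*(u)` for a slope `≤ h` polynomial `Q` lie in `M^{u ≤ h}`. -/
lemma IsSlopeLeDecomp.mem_of_QstarEval_eq_zero {R : Type*} [NormedCommRing R] {M : Type*}
    [AddCommGroup M] [Module R M] {p : ℕ} {h : ℚ} {u : Module.End R M} {Mle Mgt : Submodule R M}
    (H : IsSlopeLeDecomp p h u Mle Mgt) {Q : Polynomial R} (hQ : SlopeLePoly p h Q) {m : M}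
    (hm : QstarEval u Q m = 0) : m ∈ Mle := by
  obtain ⟨a, ha, b, hb, rfl⟩ := Submodule.mem_sup.mp
    (H.isCompl.sup_eq_top ▸ Submodule.mem_top : m ∈ Mle ⊔ Mgt)
  rw [map_add, add_eq_zero_iff_neg_eq] at hm
  have hb0 : QstarEval u Q b = 0 := by
    refine Submodule.disjoint_def.mp H.isCompl.disjoint _ ?_ (QstarEval_mem H.gt_stable Q hb)
    exact hm ▸ Mle.neg_mem (QstarEval_mem H.le_stable Q ha)
  rw [(H.equiv_gt Q hQ).2.1 b hb hb0, add_zero]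
  exact ha

/-- Let `M` be an `R`-module admitting a slope `≤ h` decomposition
`M = M^{u ≤ h} ⊕ M^{u > h}` with respect to an `R`-linear endomorphism `u`.  If `m ∈ M`
satisfies `Q*(u) m = 0` for some slope `≤ h` polynomial `Q` (with `Q*(0)` a multiplicative
unit), then `m ∈ M^{u ≤ h}`.  Consequently any `R`-linear endomorphism of `M` commuting
with `u` preserves `M^{u ≤ h}`. -/
theorem mem_slopeLe_of_annihilated
    (p : ℕ) [Fact p.Prime] {R : Type*} [NormedCommRing R] [NormedAlgebra ℚ_[p] R]
    [CompleteSpace R] (hpnorm : ∀ r : R, ‖(p : R) * r‖ = (p : ℝ)⁻¹ * ‖r‖)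
    {M : Type*} [AddCommGroup M] [Module R M] (u : Module.End R M) (h : ℚ)
    {Mle Mgt : Submodule R M} (H : IsSlopeLeDecomp p h u Mle Mgt) :
    (∀ m : M, (∃ Q : Polynomial R, SlopeLePoly p h Q ∧ QstarEval u Q m = 0) → m ∈ Mle) ∧
    (∀ φ : M →ₗ[R] M, (∀ x : M, φ (u x) = u (φ x)) → ∀ m ∈ Mle, φ m ∈ Mle) := by
  refine ⟨fun m ⟨Q, hQ, hm⟩ => H.mem_of_QstarEval_eq_zero hQ hm, fun φ hφ m hm => ?_⟩
  obtain ⟨Q, hQ, hQm⟩ := H.ann m hm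
  refine H.mem_of_QstarEval_eq_zero hQ ?_
  rw [QstarEval_apply_comm (LinearMap.ext hφ) Q m, hQm, map_zero]
end

section
/- Let M be an R-module equipped with two commuting R-linear endomorphisms U_1, U_2, and let h_1, h_2 ∈ Q. Suppose M admits a slope ≤ h_1 decomposition with respect to U_1 and a slope ≤ h_2 decomposition with respect to U_2. Then M^{U_1 ≤ h_1} is stable under U_2, and if M^{U_1 ≤ h_1} admits a slope ≤ h_2 decomposition with respect to U_2, then (M^{U_1 ≤ h_1})^{U_2 ≤ h_2} = M^{U_1 ≤ h_1} ∩ M^{U_2 ≤ h_2}. (Iterating this identity shows that the multi-slope part M^{≤ (h_1,...,h_n)} := ∩_i M^{U_i ≤ h_i} can be computed by successively taking slope decompositions one operator at a time.) -/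
/-- Evaluating a polynomial at the restriction of an endomorphism to a stable submodule agrees
with evaluating it at the endomorphism itself. -/
theorem coe_QstarEval_restrict {R : Type*} [CommRing R] {M : Type*} [AddCommGroup M] [Module R M]
    (u : Module.End R M) {N : Submodule R M} (hN : ∀ m ∈ N, u m ∈ N) (Q : Polynomial R) (x : N) :
    (QstarEval (u.restrict hN) Q x : M) = QstarEval u Q x := by
  unfold QstarEval
  induction Q.reverse using Polynomial.induction_on' with
  | add f g hf hg => simp [hf, hg]
  | monomial n a =>
    simp only [Polynomial.aeval_monomial, Module.End.mul_apply, Module.algebraMap_end_apply,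
      Submodule.coe_smul]
    rw [Module.End.pow_restrict n hN, LinearMap.coe_restrict_apply]

/-- The slope `≤ h` part consists exactly of the elements killed by some `Q*(u)` with `Q` of
slope `≤ h`. -/
theorem IsSlopeLeDecomp.mem_le_iff {R : Type*} [NormedCommRing R] {M : Type*} [AddCommGroup M]
    [Module R M] {p : ℕ} {h : ℚ} {u : Module.End R M} {Mle Mgt : Submodule R M}
    (H : IsSlopeLeDecomp p h u Mle Mgt) {m : M} :
    m ∈ Mle ↔ ∃ Q : Polynomial R, SlopeLePoly p h Q ∧ QstarEval u Q m = 0 := by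
  refine ⟨H.ann m, ?_⟩
  rintro ⟨Q, hQ, hm⟩
  obtain ⟨a, ha, b, hb, rfl⟩ := Submodule.mem_sup.mp
    (H.isCompl.sup_eq_top ▸ Submodule.mem_top : m ∈ Mle ⊔ Mgt)
  obtain ⟨hstab, hinj, -⟩ := H.equiv_gt Q hQ
  have hQa : QstarEval u Q a ∈ Mle := by
    rw [← coe_QstarEval_restrict u H.le_stable Q ⟨a, ha⟩]
    exact Subtype.property _
  rw [map_add] at hm
  have hQb : QstarEval u Q b ∈ Mle := by
    rw [eq_neg_of_add_eq_zero_right hm]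
    exact Mle.neg_mem hQa
  have hb0 : b = 0 := hinj b hb (Submodule.disjoint_def.mp H.isCompl.disjoint _ hQb (hstab b hb))
  rwa [hb0, add_zero]

/-- Let `M` be an `R`-module equipped with two commuting `R`-linear
endomorphisms `U₁, U₂` and `h₁, h₂ ∈ ℚ`.  Suppose `M` admits a slope `≤ h₁` decomposition
with respect to `U₁` and a slope `≤ h₂` decomposition with respect to `U₂`.  Then
`M^{U₁ ≤ h₁}` is stable under `U₂`, and if `M^{U₁ ≤ h₁}` admits a slope `≤ h₂`
decomposition with respect to (the restriction of) `U₂`, then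
`(M^{U₁ ≤ h₁})^{U₂ ≤ h₂} = M^{U₁ ≤ h₁} ∩ M^{U₂ ≤ h₂}`.  (Iterating this identity shows
that the multi-slope part `M^{≤ (h_1, ..., h_n)} = ∩ᵢ M^{Uᵢ ≤ hᵢ}` can be computed by
successively taking slope decompositions one operator at a time.) -/
theorem slopeLeDecomp_inf
    (p : ℕ) [Fact p.Prime] {R : Type*} [NormedCommRing R] [NormedAlgebra ℚ_[p] R]
    [CompleteSpace R] (hpnorm : ∀ r : R, ‖(p : R) * r‖ = (p : ℝ)⁻¹ * ‖r‖)
    {M : Type*} [AddCommGroup M] [Module R M] (U₁ U₂ : Module.End R M)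
    (hcomm : ∀ x : M, U₁ (U₂ x) = U₂ (U₁ x)) (h₁ h₂ : ℚ)
    {M₁le M₁gt M₂le M₂gt : Submodule R M}
    (H₁ : IsSlopeLeDecomp p h₁ U₁ M₁le M₁gt) (H₂ : IsSlopeLeDecomp p h₂ U₂ M₂le M₂gt) :
    (∀ m ∈ M₁le, U₂ m ∈ M₁le) ∧
    ∀ (hst : ∀ m : M, m ∈ M₁le → U₂ m ∈ M₁le) (Nle Ngt : Submodule R ↥M₁le),
      IsSlopeLeDecomp p h₂ (U₂.restrict hst) Nle Ngt →
      Nle.map M₁le.subtype = M₁le ⊓ M₂le := by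
  have hc : Commute U₁ U₂ := LinearMap.ext hcomm
  refine ⟨fun m hm => ?_, fun hst Nle Ngt HN => ?_⟩
  · obtain ⟨Q, hQ, hQm⟩ := H₁.ann m hm
    refine H₁.mem_le_iff.mpr ⟨Q, hQ, ?_⟩
    have hcQ : Commute U₂ (QstarEval U₁ Q) :=
      Algebra.commute_of_mem_adjoin_singleton_of_commute
        (Polynomial.aeval_mem_adjoin_singleton R U₁) hc.symm
    rw [← Module.End.mul_apply, ← hcQ.eq, Module.End.mul_apply, hQm, map_zero]
  · ext m
    rw [Submodule.mem_map, Submodule.mem_inf, H₂.mem_le_iff]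
    constructor
    · rintro ⟨x, hx, rfl⟩
      obtain ⟨Q, hQ, hQx⟩ := HN.ann x hx
      refine ⟨x.2, Q, hQ, ?_⟩
      rw [Submodule.subtype_apply, ← coe_QstarEval_restrict U₂ hst, hQx, Submodule.coe_zero]
    · rintro ⟨hm, Q, hQ, hQm⟩
      refine ⟨⟨m, hm⟩, HN.mem_le_iff.mpr ⟨Q, hQ, Subtype.ext ?_⟩, rfl⟩
      rw [coe_QstarEval_restrict U₂ hst, hQm, Submodule.coe_zero]
end

section
/- Let R be a commutative ring in which 2 is a nonzerodivisor, and set u_2 = [[1, −1], [0, 1]] and u_3 = [[1, 1], [0, 1]] in GL_2(R). If h is a 2×2 matrix over R such that h, u_2 h u_2^{−1} and u_3 h u_3^{−1} are all lower triangular, then h is a scalar matrix. (This is the identity u H u^{−1} ∩ \bar{B}_G = Z_H in the triple product example: for u = (1, u_2, u_3) ∈ GL_2^3 and H = GL_2 embedded diagonally in G = GL_2 ×_{GL_1} GL_2 ×_{GL_1} GL_2, the intersection of u H u^{−1} with the lower triangular Borel of G is the centre of H.) -/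
theorem conj_upperUnipotent_apply_zero_one {R : Type*} [CommRing R] (x : R)
    (h : Matrix (Fin 2) (Fin 2) R) :
    (!![1, x; 0, 1] * h * (!![1, x; 0, 1])⁻¹ : Matrix (Fin 2) (Fin 2) R) 0 1 =
      h 0 1 + x * (h 1 1 - h 0 0) - x ^ 2 * h 1 0 := by
  have hinv : (!![1, x; 0, 1] : Matrix (Fin 2) (Fin 2) R)⁻¹ = !![1, -x; 0, 1] :=
    Matrix.inv_eq_right_inv (by simp [Matrix.one_fin_two])
  rw [hinv]
  simp [Matrix.mul_apply, Matrix.vecMul, dotProduct, Fin.sum_univ_two]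
  ring

/-- Let `R` be a commutative ring in which `2` is a nonzerodivisor, and
set `u₂ = [[1, -1], [0, 1]]` and `u₃ = [[1, 1], [0, 1]]` in `GL₂(R)`.  If `h` is a `2 × 2`
matrix over `R` such that `h`, `u₂ h u₂⁻¹` and `u₃ h u₃⁻¹` are all lower triangular, then
`h` is a scalar matrix.  (This is the identity `u H u⁻¹ ∩ B̄_G = Z_H` in the triple product
example: for `u = (1, u₂, u₃) ∈ GL₂³` and `H = GL₂` embedded diagonally in
`G = GL₂ ×_{GL₁} GL₂ ×_{GL₁} GL₂`, the intersection of `u H u⁻¹` with the lower triangular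
Borel of `G` is the centre of `H`.) -/
theorem scalar_of_triple_conj_lowerTriangular
    (R : Type*) [CommRing R] (h2 : (2 : R) ∈ nonZeroDivisors R)
    (h : Matrix (Fin 2) (Fin 2) R)
    (hlow : h 0 1 = 0)
    (hlow₂ : ((!![1, -1; 0, 1] * h * (!![1, -1; 0, 1])⁻¹ : Matrix (Fin 2) (Fin 2) R)) 0 1 = 0)
    (hlow₃ : ((!![1, 1; 0, 1] * h * (!![1, 1; 0, 1])⁻¹ : Matrix (Fin 2) (Fin 2) R)) 0 1 = 0) :
    ∃ c : R, h = c • (1 : Matrix (Fin 2) (Fin 2) R) := by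
  rw [conj_upperUnipotent_apply_zero_one, hlow] at hlow₂ hlow₃
  have hc : h 1 0 = 0 := (mem_nonZeroDivisors_iff.mp h2).1 _ (by linear_combination -hlow₂ - hlow₃)
  have hd : h 1 1 = h 0 0 := by linear_combination hlow₃ + hc
  refine ⟨h 0 0, ?_⟩
  ext i j
  fin_cases i <;> fin_cases j <;> simp [hlow, hc, hd]
end
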